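/- arXiv:2009.07512 — 7 statements merged into one kernel-verified Lean document; each statement's English description precedes it below -/
import Mathlib

section
/- Let n, m, N ∈ ℕ with N ≥ 2, and let W_k : ℝⁿ × ℝⁿ × ℝⁿ → ℝ (k = 1, …, m) be continuous convex functions such that there exists z̄ with W_k(z̄) < 0 for all k (Slater/nondegeneracy condition). Set F = {z ∈ ℝⁿ × ℝⁿ × ℝⁿ : W_k(z) ≤ 0 for all k}. Fix t ∈ {0, …, N−2} and a point w = (x₀, …, x_N) ∈ (ℝⁿ)^{N+1} with z := (x_t, x_{t+1}, x_{t+2}) ∈ F, and let M_t = {(y₀, …, y_N) ∈ (ℝⁿ)^{N+1} : (y_t, y_{t+1}, y_{t+2}) ∈ F} and I(z) = {k : W_k(z) = 0}. Then the dual cone K*_{M_t}(w) := {w* = (x₀*, …, x_N*) : ⟨y − w, w*⟩ ≥ 0 for all y ∈ M_t} equals the set of all w* = (x₀*, …, x_N*) such that x_s* = 0 for every s ∉ {t, t+1, t+2} and (x_t*, x_{t+1}*, x_{t+2}*) = −∑_{k ∈ I(z)} α_k s_k for some nonnegative reals α_k and some subgradients s_k ∈ ∂W_k(z) (k ∈ I(z));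 in particular this triple set is {0} when I(z) = ∅. -/
open scoped RealInnerProductSpace
open Set MeasureTheory

noncomputable section

abbrev E (n : ℕ) := EuclideanSpace ℝ (Fin n)

/-- The product inner product on `ℝⁿ × ℝⁿ × ℝⁿ`. -/
def inner3 {n : ℕ} (a b : E n × E n × E n) : ℝ :=
  ⟪a.1, b.1⟫ + ⟪a.2.1, b.2.1⟫ + ⟪a.2.2, b.2.2⟫

/-- `s` is a subgradient of `g : ℝⁿ × ℝⁿ × ℝⁿ → ℝ` at `x`. -/
def IsSubgrad3 {n : ℕ} (g : E n × E n × E n → ℝ) (x s : E n × E n × E n) : Prop :=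
  ∀ y, g y - g x ≥ inner3 s (y - x)

/-- The product inner product on `ℝⁿ × ℝⁿ`. -/
def inner2 {n : ℕ} (a b : E n × E n) : ℝ :=
  ⟪a.1, b.1⟫ + ⟪a.2, b.2⟫

/-- `s` is a subgradient of `g : ℝⁿ × ℝⁿ → ℝ` at `x`. -/
def IsSubgrad2 {n : ℕ} (g : E n × E n → ℝ) (x s : E n × E n) : Prop :=
  ∀ y, g y - g x ≥ inner2 s (y - x)

/-- `s` is a subgradient of `g : ℝⁿ → ℝ` at `x`. -/
def IsSubgrad1 {n : ℕ} (g : E n → ℝ) (x s : E n) : Prop :=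
  ∀ y, g y - g x ≥ ⟪s, y - x⟫

section ConvexAnalysis

variable {X : Type*} [AddCommGroup X] [Module ℝ X]

/-- Lagrange multiplier for a single constraint on a convex set. -/
theorem exists_multiplier_of_nonneg_on_sublevel {C : Set X} {f g : X → ℝ}
    (hf : ConvexOn ℝ C f) (hg : ConvexOn ℝ C g) {x₀ : X} (hx₀ : x₀ ∈ C) (hgx₀ : g x₀ < 0)
    (h : ∀ y ∈ C, g y ≤ 0 → 0 ≤ f y) :
    ∃ a : ℝ, 0 ≤ a ∧ ∀ y ∈ C, 0 ≤ f y + a * g y := by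
  let R : Set ℝ := (fun y => f y / -g y) '' {y | y ∈ C ∧ g y < 0}
  have hRne : R.Nonempty := ⟨_, x₀, ⟨hx₀, hgx₀⟩, rfl⟩
  have hR0 : ∀ r ∈ R, 0 ≤ r := by
    rintro _ ⟨y, ⟨hyC, hy⟩, rfl⟩
    exact div_nonneg (h y hyC hy.le) (neg_pos.mpr hy).le
  refine ⟨sInf R, le_csInf hRne hR0, fun y hyC => ?_⟩
  rcases lt_trichotomy (g y) 0 with hy | hy | hy
  · have hle : sInf R ≤ f y / -g y := csInf_le ⟨0, hR0⟩ ⟨y, ⟨hyC, hy⟩, rfl⟩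
    rw [le_div_iff₀ (neg_pos.mpr hy)] at hle
    linarith
  · simpa [hy] using h y hyC hy.le
  · have hle : -f y / g y ≤ sInf R := by
      refine le_csInf hRne ?_
      rintro _ ⟨x, ⟨hxC, hx⟩, rfl⟩
      have hx' : 0 < -g x := neg_pos.mpr hx
      have hsum : 0 < g y + -g x := by linarith
      have hp : 0 ≤ g y / (g y + -g x) := by positivity
      have hq : 0 ≤ -g x / (g y + -g x) := by positivity
      have hpq : g y / (g y + -g x) + -g x / (g y + -g x) = 1 := by
        rw [← add_div, div_self hsum.ne']
      have hgc := hg.2 hxC hyC hp hq hpq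
      have hfc := hf.2 hxC hyC hp hq hpq
      have hzero : (g y / (g y + -g x)) • g x + (-g x / (g y + -g x)) • g y = 0 := by
        simp only [smul_eq_mul]
        ring
      have hnn := (h _ (hf.1 hxC hyC hp hq hpq) (hgc.trans hzero.le)).trans hfc
      have heq : (g y / (g y + -g x)) • f x + (-g x / (g y + -g x)) • f y =
          (g y * f x + -g x * f y) / (g y + -g x) := by
        simp only [smul_eq_mul]
        ring
      rw [heq, le_div_iff₀ hsum, zero_mul] at hnn
      rw [div_le_div_iff₀ hy hx']
      linarith
    rw [div_le_iff₀ hy] at hle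
    linarith

/-- Lagrange multipliers for finitely many convex constraints under the Slater condition. -/
theorem exists_multipliers_of_nonneg_on_sublevels {ι : Type*} (S : Finset ι) {f : X → ℝ}
    {W : ι → X → ℝ} (hf : ConvexOn ℝ univ f) (hW : ∀ k, ConvexOn ℝ univ (W k))
    {x₀ : X} (hx₀ : ∀ k, W k x₀ < 0) (h : ∀ y, (∀ k ∈ S, W k y ≤ 0) → 0 ≤ f y) :
    ∃ a : ι → ℝ, (∀ k, 0 ≤ a k) ∧ ∀ y, 0 ≤ f y + ∑ k ∈ S, a k * W k y := by
  classical
  induction S using Finset.induction_on generalizing f with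
  | empty => exact ⟨0, fun _ => le_rfl, fun y => by simpa using h y⟩
  | insert j S hj ih =>
    have hC : Convex ℝ {y | ∀ k ∈ S, W k y ≤ 0} := by
      have : {y | ∀ k ∈ S, W k y ≤ 0} = ⋂ k ∈ S, {y | y ∈ univ ∧ W k y ≤ 0} := by
        ext y
        simp
      rw [this]
      exact convex_iInter₂ fun k _ => (hW k).convex_le 0
    obtain ⟨b, hb, hfb⟩ := exists_multiplier_of_nonneg_on_sublevel
      (hf.subset (subset_univ _) hC) ((hW j).subset (subset_univ _) hC)
      (fun k _ => (hx₀ k).le) (hx₀ j)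
      (fun y hy hjy => h y (by simpa [Finset.forall_mem_insert] using ⟨hjy, hy⟩))
    obtain ⟨a, ha, hfa⟩ := ih (f := fun y => f y + b * W j y)
      (hf.add ((hW j).smul hb)) hfb
    refine ⟨Function.update a j b, fun k => ?_, fun y => ?_⟩
    · by_cases hk : k = j
      · subst hk
        simpa using hb
      · simpa [hk] using ha k
    · rw [Finset.sum_insert hj, Function.update_self, ← add_assoc]
      convert hfa y using 2
      refine Finset.sum_congr rfl fun k hk => ?_
      rw [Function.update_of_ne (ne_of_mem_of_not_mem hk hj)]

variable [TopologicalSpace X] [IsTopologicalAddGroup X] [ContinuousSMul ℝ X]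

/-- A nonempty convex set lying below the graph of a continuous convex function is separated
from it by the graph of a continuous affine function. -/
theorem exists_affine_between {f : X → ℝ} (hf : ConvexOn ℝ univ f) (hfc : Continuous f)
    {T : Set (X × ℝ)} (hT : Convex ℝ T) (hne : T.Nonempty) (hTf : ∀ p ∈ T, p.2 ≤ f p.1) :
    ∃ (φ : X →L[ℝ] ℝ) (b : ℝ), (∀ x, φ x + b ≤ f x) ∧ ∀ p ∈ T, p.2 ≤ φ p.1 + b := by
  have hopen : IsOpen {p : X × ℝ | p.1 ∈ univ ∧ f p.1 < p.2} := by
    simpa using isOpen_lt (hfc.comp continuous_fst) continuous_snd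
  have hdisj : Disjoint {p : X × ℝ | p.1 ∈ univ ∧ f p.1 < p.2} T :=
    Set.disjoint_left.mpr fun p hp hpT => hp.2.not_ge (hTf p hpT)
  obtain ⟨F, u, hFS, hFT⟩ :=
    geometric_hahn_banach_open hf.convex_strict_epigraph hopen hT hdisj
  have hF : ∀ x r, F (x, r) = F (x, 0) + r * F (0, 1) := fun x r => by
    rw [← smul_eq_mul, ← map_smul, ← map_add]
    simp
  obtain ⟨⟨x₀, r₀⟩, hp₀⟩ := hne
  have hc : F (0, 1) < 0 := by
    have h1 := hFT _ hp₀
    have h2 := hFS (x₀, f x₀ + 1) ⟨mem_univ _, lt_add_one _⟩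
    have h3 : r₀ ≤ f x₀ := hTf _ hp₀
    rw [hF] at h1 h2
    nlinarith
  have haff : ∀ x, ((-(F (0, 1))⁻¹) • F.comp (ContinuousLinearMap.inl ℝ X ℝ)) x + u / F (0, 1) =
      (u - F (x, 0)) / F (0, 1) := fun x => by
    simp only [smul_apply, ContinuousLinearMap.comp_apply, ContinuousLinearMap.inl_apply,
      smul_eq_mul]
    ring
  refine ⟨(-(F (0, 1))⁻¹) • F.comp (ContinuousLinearMap.inl ℝ X ℝ), u / F (0, 1),
    fun x => ?_, fun p hp => ?_⟩
  · refine le_of_forall_gt_imp_ge_of_dense fun r hr => ?_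
    have h1 := hFS (x, r) ⟨mem_univ _, hr⟩
    rw [hF] at h1
    rw [haff, div_le_iff_of_neg hc]
    linarith
  · have h1 := hFT p hp
    rw [← Prod.mk.eta (p := p), hF] at h1
    rw [haff, le_div_iff_of_neg hc]
    linarith

/-- A continuous convex function has a subgradient at every point. -/
theorem exists_subgradient {f : X → ℝ} (hf : ConvexOn ℝ univ f) (hfc : Continuous f) (z : X) :
    ∃ φ : X →L[ℝ] ℝ, ∀ y, φ (y - z) ≤ f y - f z := by
  obtain ⟨φ, b, hφ, hz⟩ := exists_affine_between hf hfc (convex_singleton (z, f z))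
    (singleton_nonempty _) (by simp)
  refine ⟨φ, fun y => ?_⟩
  have h1 := hφ y
  have h2 : f z ≤ φ z + b := hz _ rfl
  rw [map_sub]
  linarith

/-- Moreau–Rockafellar sum rule for two convex functions, the first one continuous. -/
theorem exists_subgradient_add {f g : X → ℝ} (hf : ConvexOn ℝ univ f) (hfc : Continuous f)
    (hg : ConvexOn ℝ univ g) {z : X} {φ : X →L[ℝ] ℝ}
    (hφ : ∀ y, φ (y - z) ≤ f y + g y - (f z + g z)) :
    ∃ ψ : X →L[ℝ] ℝ, (∀ y, ψ (y - z) ≤ f y - f z) ∧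
      ∀ y, (φ - ψ) (y - z) ≤ g y - g z := by
  have hconc : ConcaveOn ℝ univ fun y => φ y + (f z + g z - φ z) - g y :=
    ((φ.toLinearMap.concaveOn convex_univ).add_const _).sub hg
  obtain ⟨ψ, b, hψ, hT⟩ := exists_affine_between hf hfc hconc.convex_hypograph
    ⟨(z, f z), by simp⟩ (fun p hp => by
      have h1 := hφ p.1
      have h2 := hp.2
      rw [map_sub] at h1
      linarith)
  have hz : f z ≤ ψ z + b := hT (z, f z) (by simp)
  have hz' := hψ z
  refine ⟨ψ, fun y => ?_, fun y => ?_⟩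
  · have := hψ y
    rw [map_sub]
    linarith
  · have : φ y + (f z + g z - φ z) - g y ≤ ψ y + b := hT (y, _) ⟨mem_univ _, le_rfl⟩
    simp only [map_sub, sub_apply]
    linarith

/-- Moreau–Rockafellar sum rule for finitely many continuous convex functions. -/
theorem exists_subgradient_sum {ι : Type*} (S : Finset ι) {f : ι → X → ℝ}
    (hf : ∀ k, ConvexOn ℝ univ (f k)) (hfc : ∀ k, Continuous (f k)) {z : X} {φ : X →L[ℝ] ℝ}
    (hφ : ∀ y, φ (y - z) ≤ ∑ k ∈ S, f k y - ∑ k ∈ S, f k z) :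
    ∃ ψ : ι → X →L[ℝ] ℝ, (∀ k ∈ S, ∀ y, ψ k (y - z) ≤ f k y - f k z) ∧
      φ = ∑ k ∈ S, ψ k := by
  classical
  induction S using Finset.induction_on generalizing φ with
  | empty =>
    refine ⟨0, by simp, ?_⟩
    ext y
    have h1 := hφ (z + y)
    have h2 := hφ (z - y)
    simp at h1 h2 ⊢
    linarith
  | insert j S hj ih =>
    have hsum : ConvexOn ℝ univ fun y => ∑ k ∈ S, f k y := by
      have := Finset.sum_induction f (ConvexOn ℝ univ) (fun _ _ => ConvexOn.add)
        (convexOn_const 0 convex_univ) (s := S) fun k _ => hf k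
      convert this using 1
      ext y
      simp
    obtain ⟨χ, hχ, hrest⟩ := exists_subgradient_add (hf j) (hfc j) hsum (z := z) (φ := φ)
      (fun y => by simpa [Finset.sum_insert hj] using hφ y)
    obtain ⟨ψ, hψ, heq⟩ := ih hrest
    have hne : ∀ k ∈ S, k ≠ j := fun k hk => ne_of_mem_of_not_mem hk hj
    refine ⟨Function.update ψ j χ, ?_, ?_⟩
    · refine Finset.forall_mem_insert _ _ _ |>.mpr ⟨by simpa using hχ, fun k hk => ?_⟩
      simpa [Function.update_of_ne (hne k hk)] using hψ k hk
    · rw [Finset.sum_insert hj, Function.update_self,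
        Finset.sum_congr rfl fun k hk => Function.update_of_ne (hne k hk) _ _, ← heq]
      abel

/-- Karush–Kuhn–Tucker conditions for minimizing a continuous linear functional under finitely
many continuous convex constraints satisfying the Slater condition. -/
theorem exists_kkt_multipliers {ι : Type*} [Fintype ι] {W : ι → X → ℝ}
    (hW : ∀ k, ConvexOn ℝ univ (W k)) (hWc : ∀ k, Continuous (W k))
    {x₀ : X} (hx₀ : ∀ k, W k x₀ < 0) {z : X} (hz : ∀ k, W k z ≤ 0) {φ : X →L[ℝ] ℝ}
    (hφ : ∀ y, (∀ k, W k y ≤ 0) → 0 ≤ φ (y - z)) :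
    ∃ (a : ι → ℝ) (ψ : ι → X →L[ℝ] ℝ), (∀ k, 0 ≤ a k) ∧
      (∀ k y, ψ k (y - z) ≤ W k y - W k z) ∧ (∀ k, W k z ≠ 0 → a k = 0) ∧
      φ = -∑ k, a k • ψ k := by
  have hlin : ConvexOn ℝ univ fun y => φ (y - z) := by
    simp_rw [map_sub, sub_eq_add_neg]
    exact (φ.toLinearMap.convexOn convex_univ).add_const (-φ z)
  obtain ⟨a, ha, hL⟩ := exists_multipliers_of_nonneg_on_sublevels Finset.univ hlin hW hx₀
    (fun y hy => hφ y fun k => hy k (Finset.mem_univ k))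
  have hle : ∀ k ∈ Finset.univ, a k * W k z ≤ 0 := fun k _ =>
    mul_nonpos_of_nonneg_of_nonpos (ha k) (hz k)
  have hsum : ∑ k, a k * W k z = 0 :=
    le_antisymm (Finset.sum_nonpos hle) (by simpa using hL z)
  have hslack := (Finset.sum_eq_zero_iff_of_nonpos hle).mp hsum
  obtain ⟨χ, hχ, heq⟩ := exists_subgradient_sum Finset.univ (f := fun k y => a k * W k y)
    (z := z) (φ := -φ) (fun k => (hW k).smul (ha k)) (fun k => (hWc k).const_mul _) (fun y => by
      have := hL y
      simp only [hsum, neg_apply]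
      linarith)
  have hscale : ∀ k, ∃ ψ : X →L[ℝ] ℝ, (∀ y, ψ (y - z) ≤ W k y - W k z) ∧ χ k = a k • ψ := by
    intro k
    have hk := hχ k (Finset.mem_univ k)
    rcases (ha k).eq_or_lt with h0 | hpos
    · obtain ⟨ψ, hψ⟩ := exists_subgradient (hW k) (hWc k) z
      refine ⟨ψ, hψ, ?_⟩
      ext y
      have h1 := hk (z + y)
      have h2 := hk (z - y)
      simp [← h0] at h1 h2 ⊢
      linarith
    · refine ⟨(a k)⁻¹ • χ k, fun y => ?_, by rw [smul_inv_smul₀ hpos.ne']⟩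
      rw [smul_apply, smul_eq_mul, inv_mul_le_iff₀ hpos, mul_sub]
      exact hk y
  choose ψ hψ hχψ using hscale
  refine ⟨a, ψ, ha, hψ, fun k hk => ?_, ?_⟩
  · exact (mul_eq_zero.mp (hslack k (Finset.mem_univ k))).resolve_right hk
  · rw [← neg_eq_iff_eq_neg, heq]
    exact Finset.sum_congr rfl fun k _ => hχψ k

end ConvexAnalysis

/-- The functionals `inner3 s`, bundled as continuous linear functionals. -/
def inner3L {n : ℕ} (s : E n × E n × E n) : E n × E n × E n →L[ℝ] ℝ :=
  (innerSL ℝ s.1).coprod ((innerSL ℝ s.2.1).coprod (innerSL ℝ s.2.2))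

theorem inner3L_apply {n : ℕ} (s y : E n × E n × E n) : inner3L s y = inner3 s y := by
  simp [inner3L, inner3, add_assoc]

theorem inner3_comm {n : ℕ} (a b : E n × E n × E n) : inner3 a b = inner3 b a := by
  simp only [inner3, real_inner_comm]

theorem inner3L_neg_sum_smul {n : ℕ} {ι : Type*} [Fintype ι] (a : ι → ℝ)
    (s : ι → E n × E n × E n) :
    inner3L (-∑ k, a k • s k) = -∑ k, a k • inner3L (s k) := by
  ext y <;>
  simp [inner3L, Prod.fst_sum, Prod.snd_sum]

theorem inner3L_injective {n : ℕ} : Function.Injective (inner3L (n := n)) := by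
  intro a b h
  refine Prod.ext (ext_inner_right ℝ fun v => ?_)
    (Prod.ext (ext_inner_right ℝ fun v => ?_) (ext_inner_right ℝ fun v => ?_))
  · simpa [inner3L] using DFunLike.congr_fun h (v, 0, 0)
  · simpa [inner3L] using DFunLike.congr_fun h (0, v, 0)
  · simpa [inner3L] using DFunLike.congr_fun h (0, 0, v)

theorem inner3L_surjective {n : ℕ} : Function.Surjective (inner3L (n := n)) := by
  intro φ
  let d := (InnerProductSpace.toDual ℝ (E n)).symm
  refine ⟨(d (φ.comp (.inl ℝ _ _)), d (φ.comp ((ContinuousLinearMap.inr ℝ _ _).comp (.inl ℝ _ _))),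
    d (φ.comp ((ContinuousLinearMap.inr ℝ _ _).comp (.inr ℝ _ _)))), ?_⟩
  ext y <;> simp [inner3L, d]

theorem sum_inner_eq_inner3 {n N t : ℕ} (ht : t + 2 ≤ N) (v ws : ℕ → E n)
    (h : ∀ s, s ≤ N → s ≠ t → s ≠ t + 1 → s ≠ t + 2 → ⟪v s, ws s⟫ = 0) :
    ∑ s ∈ Finset.range (N + 1), ⟪v s, ws s⟫ =
      inner3 (v t, v (t + 1), v (t + 2)) (ws t, ws (t + 1), ws (t + 2)) := by
  rw [← Finset.sum_subset (s₁ := {t, t + 1, t + 2})]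
  · simp [inner3, add_assoc]
  · intro s
    simp only [Finset.mem_insert, Finset.mem_singleton, Finset.mem_range]
    omega
  · intro s hs hs'
    simp only [Finset.mem_insert, Finset.mem_singleton, Finset.mem_range, not_or] at hs hs'
    exact h s (by omega) hs'.1 hs'.2.1 hs'.2.2

theorem stmt3 (n m N : ℕ) (hN : 2 ≤ N)
    (W : Fin m → E n × E n × E n → ℝ)
    (hWconv : ∀ k, ConvexOn ℝ univ (W k))
    (hWcont : ∀ k, Continuous (W k))
    (zbar : E n × E n × E n) (hSlater : ∀ k, W k zbar < 0)
    (t : ℕ) (ht : t ≤ N - 2)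
    (w : ℕ → E n)
    (hzF : ∀ k, W k (w t, w (t + 1), w (t + 2)) ≤ 0)
    (ws : ℕ → E n) :
    (∀ y : ℕ → E n, (∀ k, W k (y t, y (t + 1), y (t + 2)) ≤ 0) →
        0 ≤ ∑ s ∈ Finset.range (N + 1), ⟪y s - w s, ws s⟫) ↔
      ((∀ s, s ≤ N → s ≠ t → s ≠ t + 1 → s ≠ t + 2 → ws s = 0) ∧
        ∃ (α : Fin m → ℝ) (sk : Fin m → E n × E n × E n),
          (∀ k, 0 ≤ α k) ∧
          (∀ k, W k (w t, w (t + 1), w (t + 2)) = 0 →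
            IsSubgrad3 (W k) (w t, w (t + 1), w (t + 2)) (sk k)) ∧
          (∀ k, W k (w t, w (t + 1), w (t + 2)) ≠ 0 → α k = 0) ∧
          (ws t, ws (t + 1), ws (t + 2)) = -∑ k, α k • sk k) := by
  have htN : t + 2 ≤ N := by omega
  constructor
  · intro h
    have hzero : ∀ s, s ≤ N → s ≠ t → s ≠ t + 1 → s ≠ t + 2 → ws s = 0 := by
      intro s hsN h0 h1 h2
      have := h (Function.update w s (w s - ws s)) (by
        simpa [Function.update_of_ne h0.symm, Function.update_of_ne h1.symm,
          Function.update_of_ne h2.symm] using hzF)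
      rw [Finset.sum_eq_single_of_mem s (Finset.mem_range.mpr (by omega))
        (fun r _ hr => by simp [Function.update_of_ne hr])] at this
      simp only [Function.update_self, sub_sub_cancel_left, inner_neg_left,
        Left.nonneg_neg_iff] at this
      exact real_inner_self_nonpos.mp this
    refine ⟨hzero, ?_⟩
    obtain ⟨a, ψ, ha, hψ, hslack, heq⟩ := exists_kkt_multipliers hWconv hWcont hSlater hzF
      (φ := inner3L (ws t, ws (t + 1), ws (t + 2))) (by
        rintro ⟨y₀, y₁, y₂⟩ hy
        have := h (fun s => if s = t then y₀ else if s = t + 1 then y₁ else y₂)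
          (by simpa using hy)
        rw [sum_inner_eq_inner3 htN _ _ fun s hsN h0 h1 h2 => by
          rw [hzero s hsN h0 h1 h2, inner_zero_right]] at this
        rw [inner3L_apply, inner3_comm]
        simpa using this)
    choose sk hsk using fun k => inner3L_surjective (ψ k)
    refine ⟨a, sk, ha, fun k _ y => ?_, hslack, inner3L_injective ?_⟩
    · rw [ge_iff_le, ← inner3L_apply, hsk]
      exact hψ k y
    · rw [heq, inner3L_neg_sum_smul]
      simp only [hsk]
  · rintro ⟨hzero, a, sk, ha, hsk, hslack, heq⟩ y hy
    rw [sum_inner_eq_inner3 htN _ _ fun s hsN h0 h1 h2 => by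
      rw [hzero s hsN h0 h1 h2, inner_zero_right]]
    rw [inner3_comm, heq, ← inner3L_apply, inner3L_neg_sum_smul, neg_apply,
      sum_apply, neg_nonneg]
    refine Finset.sum_nonpos fun k _ => ?_
    rw [smul_apply, smul_eq_mul, inner3L_apply]
    by_cases hk : W k (w t, w (t + 1), w (t + 2)) = 0
    · refine mul_nonpos_of_nonneg_of_nonpos (ha k) ?_
      have := hsk k hk (y t, y (t + 1), y (t + 2))
      rw [hk, sub_zero] at this
      exact this.le.trans (hy k)
    · simp [hslack k hk]
end
end

section
/- Consider problem (PD): minimize ∑_{t=2}^{N−1} f(x_t, t) over sequences (x₀, x₁, …, x_N) in ℝⁿ satisfying W_k(x_t, x_{t+1}, x_{t+2}) ≤ 0 for all t = 0, …, N−2 and k = 1, …, m, with x₀ = v̄₀ and x₁ = v̄₁, where each W_k : ℝⁿ × ℝⁿ × ℝⁿ → ℝ is convex, f(·, t) : ℝⁿ → ℝ is convex and differentiable for t = 2, …, N−2, and f(·, N−1) : ℝⁿ → ℝ is convex. Let (x̃₀, …, x̃_N) be a feasible sequence and suppose there exist nonnegative reals α_t^k (t = 0, …, N−2, k = 1, …,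 m) and vectors x_t* ∈ ℝⁿ (t = 0, …, N) and u_t* ∈ ℝⁿ (t = 0, …, N−1) such that: for each t = 0, …, N−2 there exist subgradients s_t^k ∈ ∂W_k(x̃_t, x̃_{t+1}, x̃_{t+2}) with (x_t* − u_t* − g_t, u_{t+1}*, −x_{t+2}*) = ∑_{k=1}^m α_t^k s_t^k, where g_t = ∇f(x̃_t, t) for t = 2, …, N−2 and g_t = 0 for t = 0, 1; α_t^k · W_k(x̃_t, x̃_{t+1}, x̃_{t+2}) = 0 for all t, k; x_{N−1}* − u_{N−1}* is a subgradient of f(·, N−1) at x̃_{N−1}; and x_N* = 0. Then (x̃₀, …, x̃_N) is optimal, i.e., ∑_{t=2}^{N−1} f(x_t, t) ≥ ∑_{t=2}^{N−1} f(x̃_t, t) for every feasible sequence (x₀, …, x_N). -/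
open scoped RealInnerProductSpace
open Set MeasureTheory

noncomputable section

/-- Feasibility for problem (PD). -/
def FeasiblePD (n m N : ℕ) (W : Fin m → E n × E n × E n → ℝ) (v0 v1 : E n)
    (x : ℕ → E n) : Prop :=
  (∀ t, t ≤ N - 2 → ∀ k, W k (x t, x (t + 1), x (t + 2)) ≤ 0) ∧ x 0 = v0 ∧ x 1 = v1

/-- The cost of problem (PD). -/
def costPD (n N : ℕ) (f : ℕ → E n → ℝ) (x : ℕ → E n) : ℝ :=
  ∑ t ∈ Finset.Icc 2 (N - 1), f t (x t)

theorem ConvexOn.inner_gradient_le_sub {n : ℕ} {g : E n → ℝ} (hg : ConvexOn ℝ univ g) {x : E n}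
    (hd : DifferentiableAt ℝ g x) (y : E n) : ⟪gradient g x, y - x⟫ ≤ g y - g x := by
  have hconv : ConvexOn ℝ univ (g ∘ AffineMap.lineMap (k := ℝ) x y) := by
    simpa using hg.comp_affineMap (AffineMap.lineMap (k := ℝ) x y)
  have hder : HasDerivAt (g ∘ AffineMap.lineMap (k := ℝ) x y) ⟪gradient g x, y - x⟫ 0 := by
    have h := hd.hasGradientAt.hasFDerivAt
    rw [← AffineMap.lineMap_apply_zero (k := ℝ) x y] at h
    simpa using h.comp_hasDerivAt (0 : ℝ) AffineMap.hasDerivAt_lineMap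
  simpa [slope_def_field] using
    hconv.le_slope_of_hasDerivAt (mem_univ 0) (mem_univ 1) one_pos hder

theorem inner3_sum_smul_left {n m : ℕ} (α : Fin m → ℝ) (s : Fin m → E n × E n × E n)
    (z : E n × E n × E n) : inner3 (∑ k, α k • s k) z = ∑ k, α k * inner3 (s k) z := by
  simp [inner3, Prod.fst_sum, Prod.snd_sum, sum_inner, real_inner_smul_left, mul_add,
    Finset.sum_add_distrib]

/-- A conic combination of subgradients of constraints, with complementary slackness at `p`,
makes a nonpositive inner product with every feasible direction `q - p`. -/
theorem inner3_sum_smul_sub_nonpos {n m : ℕ} {W : Fin m → E n × E n × E n → ℝ}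
    {p q : E n × E n × E n} {α : Fin m → ℝ} {s : Fin m → E n × E n × E n}
    (hα : ∀ k, 0 ≤ α k) (hs : ∀ k, IsSubgrad3 (W k) p (s k))
    (hcs : ∀ k, α k * W k p = 0) (hq : ∀ k, W k q ≤ 0) :
    inner3 (∑ k, α k • s k) (q - p) ≤ 0 := by
  rw [inner3_sum_smul_left]
  refine Finset.sum_nonpos fun k _ => ?_
  have h1 := mul_le_mul_of_nonneg_left (hs k q) (hα k)
  have h2 := mul_nonpos_of_nonneg_of_nonpos (hα k) (hq k)
  have h3 := hcs k
  rw [mul_sub] at h1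
  linarith

/-- Telescoping of a second order recursive inequality. -/
theorem le_add_sum_of_second_order {a b c : ℕ → ℝ} {M : ℕ} (ha0 : a 0 = 0) (ha1 : a 1 = 0)
    (hb0 : b 0 = 0) (hc0 : c 0 = 0) (hc1 : c 1 = 0)
    (h : ∀ t, t ≤ M → a t - b t - c t + b (t + 1) - a (t + 2) ≤ 0) {T : ℕ} (hT : 2 ≤ T) :
    T ≤ M + 1 → b T ≤ a T + a (T + 1) + ∑ t ∈ Finset.Ico 2 T, c t := by
  induction T, hT using Nat.le_induction with
  | base =>
    intro hM
    have h0 := h 0 (by omega)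
    have h1 := h 1 (by omega)
    norm_num at h0 h1 ⊢
    linarith
  | succ T hT ih =>
    intro hM
    have h0 := h T (by omega)
    have h1 := ih (by omega)
    rw [Finset.sum_Ico_succ_top hT]
    linarith

theorem stmt5 (n m N : ℕ) (hN : 5 ≤ N) (v0 v1 : E n)
    (W : Fin m → E n × E n × E n → ℝ)
    (hWconv : ∀ k, ConvexOn ℝ univ (W k))
    (f : ℕ → E n → ℝ)
    (hfconv : ∀ t, 2 ≤ t → t ≤ N - 2 → ConvexOn ℝ univ (f t))
    (hfdiff : ∀ t, 2 ≤ t → t ≤ N - 2 → Differentiable ℝ (f t))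
    (hfN1conv : ConvexOn ℝ univ (f (N - 1)))
    (xtil : ℕ → E n)
    (hfeas : FeasiblePD n m N W v0 v1 xtil)
    (α : ℕ → Fin m → ℝ) (hα : ∀ t k, 0 ≤ α t k)
    (xs : ℕ → E n) (us : ℕ → E n)
    -- second order adjoint discrete inclusions, with g_t = ∇f(x̃_t, t) for
    -- t = 2, …, N−2 and g_t = 0 for t = 0, 1
    (hadj : ∀ t, t ≤ N - 2 →
      ∃ sk : Fin m → E n × E n × E n,
        (∀ k, IsSubgrad3 (W k) (xtil t, xtil (t + 1), xtil (t + 2)) (sk k)) ∧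
        (xs t - us t - (if 2 ≤ t then gradient (f t) (xtil t) else 0),
            us (t + 1), -xs (t + 2)) = ∑ k, α t k • sk k)
    -- complementary slackness
    (hcs : ∀ t, t ≤ N - 2 → ∀ k, α t k * W k (xtil t, xtil (t + 1), xtil (t + 2)) = 0)
    -- boundary conditions
    (htrans : IsSubgrad1 (f (N - 1)) (xtil (N - 1)) (xs (N - 1) - us (N - 1)))
    (hend : xs N = 0) :
    ∀ x : ℕ → E n, FeasiblePD n m N W v0 v1 x →
      costPD n N f xtil ≤ costPD n N f x := by
  intro x hx
  obtain ⟨hW, hx0, hx1⟩ := hx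
  obtain ⟨-, ht0, ht1⟩ := hfeas
  have hd0 : x 0 - xtil 0 = 0 := by rw [hx0, ht0, sub_self]
  have hd1 : x 1 - xtil 1 = 0 := by rw [hx1, ht1, sub_self]
  have hstep : ∀ t, t ≤ N - 2 →
      ⟪xs t, x t - xtil t⟫ - ⟪us t, x t - xtil t⟫
        - ⟪if 2 ≤ t then gradient (f t) (xtil t) else 0, x t - xtil t⟫
        + ⟪us (t + 1), x (t + 1) - xtil (t + 1)⟫
        - ⟪xs (t + 2), x (t + 2) - xtil (t + 2)⟫ ≤ 0 := by
    intro t ht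
    obtain ⟨sk, hsk, heq⟩ := hadj t ht
    have h := inner3_sum_smul_sub_nonpos (hα t) hsk (hcs t ht) (hW t ht)
    rw [← heq] at h
    simp only [inner3, Prod.fst_sub, Prod.snd_sub, inner_sub_left, inner_neg_left] at h
    linarith
  have hsum := le_add_sum_of_second_order
    (a := fun t => ⟪xs t, x t - xtil t⟫) (b := fun t => ⟪us t, x t - xtil t⟫)
    (c := fun t => ⟪if 2 ≤ t then gradient (f t) (xtil t) else 0, x t - xtil t⟫)
    (M := N - 2) (by simp [hd0]) (by simp [hd1]) (by simp [hd0]) (by simp) (by simp) hstep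
    (T := N - 1) (by omega) (by omega)
  have hgrad : ∑ t ∈ Finset.Ico 2 (N - 1),
        ⟪if 2 ≤ t then gradient (f t) (xtil t) else 0, x t - xtil t⟫
      ≤ ∑ t ∈ Finset.Ico 2 (N - 1), (f t (x t) - f t (xtil t)) := by
    refine Finset.sum_le_sum fun t ht => ?_
    obtain ⟨h2, hlt⟩ := Finset.mem_Ico.mp ht
    rw [if_pos h2]
    exact (hfconv t h2 (by omega)).inner_gradient_le_sub (hfdiff t h2 (by omega) _) _
  have hlast := htrans (x (N - 1))
  rw [inner_sub_left] at hlast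
  have hN1 : N - 1 + 1 = N := by omega
  simp only [hN1, hend, inner_zero_left] at hsum
  rw [Finset.sum_sub_distrib] at hgrad
  have hsplit : Finset.Icc 2 (N - 1) = Finset.Ico 2 (N - 1 + 1) := by
    ext t
    simp only [Finset.mem_Icc, Finset.mem_Ico]
    omega
  simp only [costPD, hsplit]
  rw [Finset.sum_Ico_succ_top (by omega), Finset.sum_Ico_succ_top (by omega)]
  linarith
end
end

section
/- Let N ∈ ℕ with N ≥ 5 and δ = 1/N, with grid T_δ = {0, δ, 2δ, …, 1}. For a grid function x : T_δ → ℝⁿ set Δx(t) = δ⁻¹(x(t+δ) − x(t)) and Δ²x(t) = δ⁻²(x(t+2δ) − 2x(t+δ) + x(t)). Consider the discrete-approximation problem (PDA): minimize ∑_{t=2δ, 3δ, …, 1−2δ} δ·f(x(t), t) + q(x(1−δ)) over grid functions x satisfying W_k(x(t), Δx(t), Δ²x(t)) ≤ 0 for t = 0, δ, …, 1−2δ and k = 1, …, m, with x(0) = v₀ and Δx(0) = v₁, where each W_k : ℝⁿ × ℝⁿ × ℝⁿ → ℝ is convex, q : ℝⁿ → ℝ is convex, and each f(·, t) : ℝⁿ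 → ℝ is convex and differentiable. Let x̃ be a feasible grid function and suppose there exist nonnegative reals α_k(t) (t = 0, δ, …, 1−2δ, k = 1, …, m) and grid vectors x*(t) (t = 0, …, 1) and u*(t) (t = 0, …, 1−δ) such that: for each t = 0, δ, …, 1−2δ there exist subgradients s_k(t) ∈ ∂W_k(x̃(t), Δx̃(t), Δ²x̃(t)) with (δ⁻²(x*(t) − u*(t) + u*(t+δ) − x*(t+2δ) − δ·g_t), δ⁻¹(u*(t+δ) − 2x*(t+2δ)), −x*(t+2δ)) = ∑_{k=1}^m α_k(t) s_k(t), where g_t = ∇f(x̃(t), t) for t ≥ 2δ and g_t = 0 for t = 0, δ; α_k(t)·W_k(x̃(t), Δx̃(t), Δ²x̃(t)) = 0 for all t, k; x*(1−δ) − u*(1−δ) is a subgradient of q at x̃(1−δ); and x*(1) = 0. Then x̃ is optimal: every feasible grid function x satisfies ∑_{t=2δ}^{1−2δ} δ·f(x(t), t) + q(x(1−δ)) ≥ ∑_{t=2δ}^{1−2δ} δ·f(x̃(t), t) + q(x̃(1−δ)). -/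
open scoped RealInnerProductSpace
open Set MeasureTheory

noncomputable section

/-- First-order forward difference with step `δ` of a grid function
(indexed by `j`, representing the grid point `t = j·δ`). -/
def dOp {n : ℕ} (δ : ℝ) (g : ℕ → E n) : ℕ → E n := fun j => δ⁻¹ • (g (j + 1) - g j)

/-- Feasibility for the discrete-approximation problem (PDA); the grid point
`t = j·δ` is represented by the index `j`, with `δ = 1/N`. -/
def FeasiblePDA (n m N : ℕ) (δ : ℝ) (W : Fin m → E n × E n × E n → ℝ)
    (v0 v1 : E n) (x : ℕ → E n) : Prop :=
  (∀ j, j ≤ N - 2 → ∀ k, W k (x j, dOp δ x j, dOp δ (dOp δ x) j) ≤ 0) ∧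
  x 0 = v0 ∧ dOp δ x 0 = v1

/-- The cost of the discrete-approximation problem (PDA). -/
def costPDA (n N : ℕ) (δ : ℝ) (f : ℕ → E n → ℝ) (q : E n → ℝ) (x : ℕ → E n) : ℝ :=
  (∑ j ∈ Finset.Icc 2 (N - 2), δ * f j (x j)) + q (x (N - 1))

lemma ConvexOn.isSubgrad1_gradient {n : ℕ} {g : E n → ℝ} (hg : ConvexOn ℝ univ g) {x : E n}
    (hd : DifferentiableAt ℝ g x) : IsSubgrad1 g x (gradient g x) := by
  intro y
  have hconv : ConvexOn ℝ univ (fun t : ℝ => g (AffineMap.lineMap x y t)) :=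
    hg.comp_affineMap (AffineMap.lineMap x y)
  have hderiv : HasDerivAt (fun t : ℝ => g (AffineMap.lineMap x y t)) ⟪gradient g x, y - x⟫ 0 := by
    have h1 : HasFDerivAt g (InnerProductSpace.toDual ℝ (E n) (gradient g x))
        (AffineMap.lineMap x y (0 : ℝ)) := by
      simpa using hd.hasGradientAt.hasFDerivAt
    exact h1.comp_hasDerivAt (0 : ℝ) AffineMap.hasDerivAt_lineMap
  have h := hconv.le_slope_of_hasDerivAt (mem_univ 0) (mem_univ 1) one_pos hderiv
  simpa [slope_def_field] using h

lemma inner3_sum_smul_left_s6 {n : ℕ} {ι : Type*} (s : Finset ι) (a : ι → ℝ)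
    (v : ι → E n × E n × E n) (d : E n × E n × E n) :
    inner3 (∑ k ∈ s, a k • v k) d = ∑ k ∈ s, a k * inner3 (v k) d := by
  simp only [inner3, Prod.fst_sum, Prod.snd_sum, Prod.smul_fst, Prod.smul_snd, sum_inner,
    real_inner_smul_left, mul_add, Finset.sum_add_distrib]

/-- A nonnegative combination of subgradients, with multipliers complementary to the values at the
base point, is nonpositive along directions leading to points where all functions are nonpositive. -/
lemma inner3_multiplier_nonpos {n m : ℕ} {W : Fin m → E n × E n × E n → ℝ}
    {z w : E n × E n × E n} {a : Fin m → ℝ} {s : Fin m → E n × E n × E n} (ha : ∀ k, 0 ≤ a k)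
    (hs : ∀ k, IsSubgrad3 (W k) z (s k)) (hz : ∀ k, a k * W k z = 0) (hw : ∀ k, W k w ≤ 0) :
    inner3 (∑ k, a k • s k) (w - z) ≤ 0 := by
  rw [inner3_sum_smul_left_s6]
  refine Finset.sum_nonpos fun k _ => ?_
  have h1 := mul_le_mul_of_nonneg_left (hs k w) (ha k)
  have h2 := mul_nonpos_of_nonneg_of_nonpos (ha k) (hw k)
  linarith [hz k, mul_sub (a k) (W k w) (W k z)]

/-- Discrete integration by parts for the second order adjoint expression. -/
lemma inner3_adjoint_dOp {n : ℕ} {δ : ℝ} (hδ : δ ≠ 0) (p u x z : ℕ → E n) (g : E n) (j : ℕ) :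
    inner3 ((δ ^ 2)⁻¹ • (p j - u j + u (j + 1) - p (j + 2) - δ • g),
        δ⁻¹ • (u (j + 1) - (2 : ℝ) • p (j + 2)), -p (j + 2))
        ((x j, dOp δ x j, dOp δ (dOp δ x) j) - (z j, dOp δ z j, dOp δ (dOp δ z) j)) =
      (δ ^ 2)⁻¹ * (⟪p j, x j - z j⟫ - ⟪p (j + 2), x (j + 2) - z (j + 2)⟫ +
        ⟪u (j + 1), x (j + 1) - z (j + 1)⟫ - ⟪u j, x j - z j⟫ - δ * ⟪g, x j - z j⟫) := by
  simp only [inner3, dOp, Prod.mk_sub_mk, inner_sub_left, inner_sub_right, inner_add_left,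
    real_inner_smul_left, real_inner_smul_right, inner_neg_left]
  field_simp
  ring

lemma sum_range_adjoint_telescope (A B G : ℕ → ℝ) (M : ℕ) :
    ∑ j ∈ Finset.range M, (A j - A (j + 2) + B (j + 1) - B j - G j) =
      A 0 + A 1 - A M - A (M + 1) + B M - B 0 - ∑ j ∈ Finset.range M, G j := by
  induction M with
  | zero => simp
  | succ M ih => rw [Finset.sum_range_succ, Finset.sum_range_succ, ih]; ring

theorem stmt6 (n m N : ℕ) (hN : 5 ≤ N) (δ : ℝ) (hδ : δ = (N : ℝ)⁻¹)
    (v0 v1 : E n)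
    (W : Fin m → E n × E n × E n → ℝ)
    (hWconv : ∀ k, ConvexOn ℝ univ (W k))
    (q : E n → ℝ) (hq : ConvexOn ℝ univ q)
    (f : ℕ → E n → ℝ)
    (hfconv : ∀ j, ConvexOn ℝ univ (f j))
    (hfdiff : ∀ j, Differentiable ℝ (f j))
    (xtil : ℕ → E n)
    (hfeas : FeasiblePDA n m N δ W v0 v1 xtil)
    (α : ℕ → Fin m → ℝ) (hα : ∀ j k, 0 ≤ α j k)
    (xs us : ℕ → E n)
    -- second order adjoint inclusions generated by the inequality constraints,
    -- with g_t = ∇f(x̃(t), t) for t ≥ 2δ and g_t = 0 for t = 0, δ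
    (hadj : ∀ j, j ≤ N - 2 →
      ∃ sk : Fin m → E n × E n × E n,
        (∀ k, IsSubgrad3 (W k) (xtil j, dOp δ xtil j, dOp δ (dOp δ xtil) j) (sk k)) ∧
        ((δ ^ 2)⁻¹ • (xs j - us j + us (j + 1) - xs (j + 2) -
              δ • (if 2 ≤ j then gradient (f j) (xtil j) else 0)),
          δ⁻¹ • (us (j + 1) - (2 : ℝ) • xs (j + 2)), -xs (j + 2)) =
          ∑ k, α j k • sk k)
    -- complementary slackness
    (hcs : ∀ j, j ≤ N - 2 → ∀ k,
      α j k * W k (xtil j, dOp δ xtil j, dOp δ (dOp δ xtil) j) = 0)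
    -- boundary conditions
    (htrans : IsSubgrad1 q (xtil (N - 1)) (xs (N - 1) - us (N - 1)))
    (hend : xs N = 0) :
    ∀ x : ℕ → E n, FeasiblePDA n m N δ W v0 v1 x →
      costPDA n N δ f q x ≥ costPDA n N δ f q xtil := by
  intro x hx
  have hNpos : (0 : ℝ) < N := by exact_mod_cast (by omega : 0 < N)
  have hδpos : 0 < δ := hδ ▸ inv_pos.mpr hNpos
  have h0 : x 0 = xtil 0 := hx.2.1.trans hfeas.2.1.symm
  have h1 : x 1 = xtil 1 := by
    have h : δ⁻¹ • (x 1 - x 0) = δ⁻¹ • (xtil 1 - xtil 0) := hx.2.2.trans hfeas.2.2.symm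
    rw [h0] at h
    exact sub_left_injective (smul_right_injective (E n) (inv_ne_zero hδpos.ne') h)
  set g : ℕ → E n := fun j => if 2 ≤ j then gradient (f j) (xtil j) else 0 with hg
  set A : ℕ → ℝ := fun j => ⟪xs j, x j - xtil j⟫ with hA
  set B : ℕ → ℝ := fun j => ⟪us j, x j - xtil j⟫ with hB
  set G : ℕ → ℝ := fun j => δ * ⟪g j, x j - xtil j⟫ with hG
  have hstep : ∀ j ∈ Finset.range (N - 1),
      A j - A (j + 2) + B (j + 1) - B j - G j ≤ 0 := by
    intro j hj
    have hj' : j ≤ N - 2 := by have := Finset.mem_range.mp hj; omega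
    obtain ⟨sk, hsk, heq⟩ := hadj j hj'
    have h := inner3_multiplier_nonpos (hα j) hsk (hcs j hj') (hx.1 j hj')
    rw [← heq, inner3_adjoint_dOp hδpos.ne'] at h
    exact nonpos_of_mul_nonpos_right h (by positivity)
  have htotal := Finset.sum_nonpos hstep
  rw [sum_range_adjoint_telescope] at htotal
  have hA0 : A 0 = 0 := by simp [hA, h0]
  have hA1 : A 1 = 0 := by simp [hA, h1]
  have hB0 : B 0 = 0 := by simp [hB, h0]
  have hAN : A (N - 1 + 1) = 0 := by
    rw [Nat.sub_add_cancel (by omega)]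
    simp [hA, hend]
  have hGsum : ∑ j ∈ Finset.range (N - 1), G j = ∑ j ∈ Finset.Icc 2 (N - 2), G j := by
    symm
    refine Finset.sum_subset (fun j hj => ?_) fun j hj hj' => ?_
    · simp only [Finset.mem_Icc, Finset.mem_range] at *
      omega
    · have : ¬ 2 ≤ j := by
        simp only [Finset.mem_Icc, Finset.mem_range] at *
        omega
      simp [hG, hg, this]
  have hGle : ∑ j ∈ Finset.Icc 2 (N - 2), G j ≤
      ∑ j ∈ Finset.Icc 2 (N - 2), (δ * f j (x j) - δ * f j (xtil j)) := by
    refine Finset.sum_le_sum fun j hj => ?_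
    have h := (hfconv j).isSubgrad1_gradient (hfdiff j (xtil j)) (x j)
    simp only [hG, hg, if_pos (Finset.mem_Icc.mp hj).1, ← mul_sub]
    exact mul_le_mul_of_nonneg_left h hδpos.le
  rw [Finset.sum_sub_distrib] at hGle
  have hqle := htrans (x (N - 1))
  have hAB : ⟪xs (N - 1) - us (N - 1), x (N - 1) - xtil (N - 1)⟫ = A (N - 1) - B (N - 1) :=
    inner_sub_left _ _ _
  simp only [costPDA]
  linarith
end
end

section
/- Let δ > 0, let W¹_k : ℝⁿ × ℝⁿ → ℝ (k = 1, …, m) be convex, and define Φ_k(x, v₁, v₂) = W¹_k(x, δ⁻²(v₂ − 2v₁ + x)). Fix a grid point t and vectors x̃(t), x̃(t+δ), x̃(t+2δ), x*(t), x*(t+δ), x*(t+2δ), u*(t), u*(t+δ), a ∈ ℝⁿ and nonnegative reals α_k. Suppose there exist subgradients σ_k ∈ ∂Φ_k(x̃(t), x̃(t+δ), x̃(t+2δ)) with (x*(t) − u*(t) − a, u*(t+δ), −x*(t+2δ)) = ∑_{k=1}^m α_k σ_k, and suppose moreover u*(t) = 2x*(t+δ). Then u*(t+δ) = 2x*(t+2δ),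 and there exist subgradients s_k ∈ ∂W¹_k(x̃(t), δ⁻²(x̃(t+2δ) − 2x̃(t+δ) + x̃(t))) such that (δ⁻²(x*(t+2δ) − 2x*(t+δ) + x*(t)) − δ⁻²·a, −x*(t+2δ)) = ∑_{k=1}^m (α_k/δ²) s_k. -/
open scoped RealInnerProductSpace
open Set MeasureTheory

noncomputable section

/-- The second-difference map `(x, v₁, v₂) ↦ (x, c (v₂ - 2 v₁ + x))` is constant along
`(0, w, 2 w)`, which forces the last two components of a subgradient to be proportional. -/
theorem IsSubgrad3.snd_fst_eq {n : ℕ} {c : ℝ} {W : E n × E n → ℝ} {Φ : E n × E n × E n → ℝ}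
    (hΦ : ∀ x v₁ v₂ : E n, Φ (x, v₁, v₂) = W (x, c • (v₂ - (2 : ℝ) • v₁ + x)))
    {x v₁ v₂ : E n} {σ : E n × E n × E n} (hσ : IsSubgrad3 Φ (x, v₁, v₂) σ) :
    σ.2.1 = -((2 : ℝ) • σ.2.2) := by
  have h := hσ (x, v₁ + (σ.2.1 + (2 : ℝ) • σ.2.2), v₂ + (2 : ℝ) • (σ.2.1 + (2 : ℝ) • σ.2.2))
  rw [hΦ, hΦ, show v₂ + (2 : ℝ) • (σ.2.1 + (2 : ℝ) • σ.2.2)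
      - (2 : ℝ) • (v₁ + (σ.2.1 + (2 : ℝ) • σ.2.2)) + x = v₂ - (2 : ℝ) • v₁ + x by module] at h
  simp only [inner3, Prod.mk_sub_mk, sub_self, add_sub_cancel_left, inner_zero_right,
    zero_add, inner_smul_right] at h
  rw [← real_inner_smul_left, ← inner_add_left] at h
  exact eq_neg_of_add_eq_zero_left (real_inner_self_nonpos.mp h)

/-- A subgradient of `(x, v₁, v₂) ↦ W (x, c (v₂ - 2 v₁ + x))` comes from a subgradient of `W`. -/
theorem IsSubgrad3.isSubgrad2 {n : ℕ} {c : ℝ} (hc : c ≠ 0) {W : E n × E n → ℝ}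
    {Φ : E n × E n × E n → ℝ}
    (hΦ : ∀ x v₁ v₂ : E n, Φ (x, v₁, v₂) = W (x, c⁻¹ • (v₂ - (2 : ℝ) • v₁ + x)))
    {x v₁ v₂ : E n} {σ : E n × E n × E n} (hσ : IsSubgrad3 Φ (x, v₁, v₂) σ) :
    IsSubgrad2 W (x, c⁻¹ • (v₂ - (2 : ℝ) • v₁ + x)) (σ.1 - σ.2.2, c • σ.2.2) := by
  rintro ⟨y, z⟩
  have h := hσ (y, v₁, c • z + (2 : ℝ) • v₁ - y)
  rw [hΦ, hΦ, show c • z + (2 : ℝ) • v₁ - y - (2 : ℝ) • v₁ + y = c • z by module,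
    inv_smul_smul₀ hc] at h
  refine h.trans' (le_of_eq ?_)
  have e : c • (z - c⁻¹ • (v₂ - (2 : ℝ) • v₁ + x)) =
      (c • z + (2 : ℝ) • v₁ - y - v₂) + (y - x) := by
    rw [smul_sub, smul_inv_smul₀ hc]
    module
  simp only [inner2, inner3, Prod.mk_sub_mk, sub_self, inner_zero_right]
  rw [real_inner_smul_left, ← inner_smul_right, e, inner_sub_left, inner_add_right]
  ring

theorem stmt7 (n m : ℕ) (δ : ℝ) (hδ : 0 < δ)
    (W1 : Fin m → E n × E n → ℝ) (hW1 : ∀ k, ConvexOn ℝ univ (W1 k))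
    (Φ : Fin m → E n × E n × E n → ℝ)
    (hΦ : ∀ k (x v₁ v₂ : E n),
      Φ k (x, v₁, v₂) = W1 k (x, (δ ^ 2)⁻¹ • (v₂ - (2 : ℝ) • v₁ + x)))
    -- the values x̃(t), x̃(t+δ), x̃(t+2δ), x*(t), x*(t+δ), x*(t+2δ), u*(t), u*(t+δ), a
    (xt xtd xt2d Xt Xtd Xt2d Ut Utd a : E n)
    (α : Fin m → ℝ) (hα : ∀ k, 0 ≤ α k)
    (σ : Fin m → E n × E n × E n)
    (hσ : ∀ k, IsSubgrad3 (Φ k) (xt, xtd, xt2d) (σ k))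
    (heq : (Xt - Ut - a, Utd, -Xt2d) = ∑ k, α k • σ k)
    (hu : Ut = (2 : ℝ) • Xtd) :
    Utd = (2 : ℝ) • Xt2d ∧
    ∃ s : Fin m → E n × E n,
      (∀ k, IsSubgrad2 (W1 k) (xt, (δ ^ 2)⁻¹ • (xt2d - (2 : ℝ) • xtd + xt)) (s k)) ∧
      ((δ ^ 2)⁻¹ • (Xt2d - (2 : ℝ) • Xtd + Xt) - (δ ^ 2)⁻¹ • a, -Xt2d) =
        ∑ k, (α k / δ ^ 2) • s k := by
  have h₁ := congrArg Prod.fst heq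
  have h₂ := congrArg (fun p => p.2.1) heq
  have h₃ := congrArg (fun p => p.2.2) heq
  simp only [Prod.fst_sum, Prod.snd_sum, Prod.smul_fst, Prod.smul_snd] at h₁ h₂ h₃
  have hδ2 : δ ^ 2 ≠ 0 := by positivity
  refine ⟨?_, fun k => ((σ k).1 - (σ k).2.2, δ ^ 2 • (σ k).2.2),
    fun k => (hσ k).isSubgrad2 hδ2 (hΦ k), ?_⟩
  · rw [h₂, ← neg_neg Xt2d, h₃, smul_neg, Finset.smul_sum, ← Finset.sum_neg_distrib]
    refine Finset.sum_congr rfl fun k _ => ?_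
    rw [(hσ k).snd_fst_eq (hΦ k), smul_neg, smul_comm]
  · ext1
    · simp only [Prod.fst_sum, Prod.smul_fst, div_eq_inv_mul, mul_smul, smul_sub,
        Finset.sum_sub_distrib, ← Finset.smul_sum]
      rw [← h₁, ← h₃, hu]
      module
    · simp only [Prod.snd_sum, Prod.smul_snd, smul_smul, div_mul_cancel₀ _ hδ2]
      exact h₃
end
end

section
/- Let δ > 0, let W²_k : ℝⁿ × ℝⁿ → ℝ (k = 1, …, m) be convex, and define Φ_k(x, v₁, v₂) = W²_k(x, δ⁻¹(v₁ − x)). Fix a grid point t and vectors x̃(t), x̃(t+δ), x̃(t+2δ), x*(t), x*(t+2δ), u*(t), u*(t+δ), a ∈ ℝⁿ and nonnegative reals α_k. Suppose there exist subgradients σ_k ∈ ∂Φ_k(x̃(t), x̃(t+δ), x̃(t+2δ)) with (x*(t) − u*(t) − a, u*(t+δ), −x*(t+2δ)) = ∑_{k=1}^m α_k σ_k. Then x*(t+2δ) = 0, and if moreover x*(t) = 0, there exist subgradients s_k ∈ ∂W²_k(x̃(t), δ⁻¹(x̃(t+δ) − x̃(t))) such that (δ⁻¹(u*(t+δ) −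 u*(t)) − δ⁻¹·a, u*(t+δ)) = ∑_{k=1}^m (α_k/δ) s_k. -/
open scoped RealInnerProductSpace
open Set MeasureTheory

noncomputable section

/-- A subgradient of a function of `(x, v₁, v₂)` that does not depend on `v₂` has zero third
component. -/
theorem IsSubgrad3.third_eq_zero {n : ℕ} {g : E n × E n × E n → ℝ} {x v₁ v₂ : E n}
    {s : E n × E n × E n} (hs : IsSubgrad3 g (x, v₁, v₂) s)
    (hg : ∀ w, g (x, v₁, w) = g (x, v₁, v₂)) : s.2.2 = 0 := by
  have h := hs (x, v₁, v₂ + s.2.2)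
  rw [hg] at h
  simp only [inner3, Prod.mk_sub_mk, sub_self, inner_zero_right, add_sub_cancel_left,
    zero_add, ge_iff_le] at h
  exact real_inner_self_nonpos.mp h

/-- A subgradient of `(x, v₁, v₂) ↦ W (x, δ⁻¹ (v₁ - x))` induces a subgradient of `W`. -/
theorem IsSubgrad3.isSubgrad2_of_difference {n : ℕ} {δ : ℝ} (hδ : δ ≠ 0) {W : E n × E n → ℝ}
    {g : E n × E n × E n → ℝ} (hg : ∀ x v₁ v₂ : E n, g (x, v₁, v₂) = W (x, δ⁻¹ • (v₁ - x)))
    {x v₁ v₂ : E n} {s : E n × E n × E n} (hs : IsSubgrad3 g (x, v₁, v₂) s) :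
    IsSubgrad2 W (x, δ⁻¹ • (v₁ - x)) (s.1 + s.2.1, δ • s.2.1) := by
  rintro ⟨p, q⟩
  have h := hs (p, p + δ • q, v₂)
  rw [hg, hg, add_sub_cancel_left, inv_smul_smul₀ hδ] at h
  convert h using 1
  have e : δ • (q - δ⁻¹ • (v₁ - x)) = (p + δ • q - v₁) - (p - x) := by
    rw [smul_sub, smul_inv_smul₀ hδ]
    abel
  simp only [inner2, inner3, Prod.mk_sub_mk, sub_self, inner_zero_right]
  rw [real_inner_smul_left, ← real_inner_smul_right, e, inner_add_left,
    inner_sub_right _ (p + δ • q - v₁)]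
  ring

theorem stmt8 (n m : ℕ) (δ : ℝ) (hδ : 0 < δ)
    (W2 : Fin m → E n × E n → ℝ) (hW2 : ∀ k, ConvexOn ℝ univ (W2 k))
    (Φ : Fin m → E n × E n × E n → ℝ)
    (hΦ : ∀ k (x v₁ v₂ : E n), Φ k (x, v₁, v₂) = W2 k (x, δ⁻¹ • (v₁ - x)))
    -- the values x̃(t), x̃(t+δ), x̃(t+2δ), x*(t), x*(t+2δ), u*(t), u*(t+δ), a
    (xt xtd xt2d Xt Xt2d Ut Utd a : E n)
    (α : Fin m → ℝ) (hα : ∀ k, 0 ≤ α k)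
    (σ : Fin m → E n × E n × E n)
    (hσ : ∀ k, IsSubgrad3 (Φ k) (xt, xtd, xt2d) (σ k))
    (heq : (Xt - Ut - a, Utd, -Xt2d) = ∑ k, α k • σ k) :
    Xt2d = 0 ∧
    (Xt = 0 →
      ∃ s : Fin m → E n × E n,
        (∀ k, IsSubgrad2 (W2 k) (xt, δ⁻¹ • (xtd - xt)) (s k)) ∧
        (δ⁻¹ • (Utd - Ut) - δ⁻¹ • a, Utd) = ∑ k, (α k / δ) • s k) := by
  have h₁ : Xt - Ut - a = ∑ k, α k • (σ k).1 := by
    simpa [Prod.fst_sum] using congrArg Prod.fst heq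
  have h₂ : Utd = ∑ k, α k • (σ k).2.1 := by
    simpa [Prod.fst_sum, Prod.snd_sum] using congrArg (fun z => z.2.1) heq
  have h₃ : -Xt2d = ∑ k, α k • (σ k).2.2 := by
    simpa [Prod.snd_sum] using congrArg (fun z => z.2.2) heq
  have hσ₃ : ∀ k, (σ k).2.2 = 0 := fun k =>
    (hσ k).third_eq_zero fun w => by rw [hΦ, hΦ]
  refine ⟨by simpa [hσ₃] using h₃, fun hX => ⟨fun k => ((σ k).1 + (σ k).2.1, δ • (σ k).2.1),
    fun k => (hσ k).isSubgrad2_of_difference hδ.ne' (hΦ k), Prod.ext ?_ ?_⟩⟩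
  · have hsum : δ⁻¹ • (Utd - Ut) - δ⁻¹ • a = δ⁻¹ • ((Xt - Ut - a) + Utd) := by
      rw [hX, ← smul_sub]
      congr 1
      abel
    rw [Prod.fst_sum]
    dsimp only
    rw [hsum, h₁, h₂, ← Finset.sum_add_distrib, Finset.smul_sum]
    refine Finset.sum_congr rfl fun k _ => ?_
    simp only [Prod.smul_mk, ← smul_add, smul_smul, div_eq_inv_mul]
  · rw [Prod.snd_sum]
    dsimp only
    rw [h₂]
    refine Finset.sum_congr rfl fun k _ => ?_
    simp only [Prod.smul_mk, smul_smul, div_mul_cancel₀ _ hδ.ne']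
end
end

section
/- Let P₀, P₁, Q be real m × n matrices with rows p_k⁰, p_k¹, p_k² (k = 1, …, m), let d ∈ ℝᵐ, let q : ℝⁿ → ℝ be convex, and let v₀, v₁ ∈ ℝⁿ. Call an arc x : [0,1] → ℝⁿ feasible if x is twice differentiable with integrable second derivative, P₀x(t) + P₁x'(t) − Qx''(t) ≤ d componentwise for a.e. t ∈ [0,1], and x(0) = v₀, x'(0) = v₁. Let x̃ be a feasible arc and suppose there exists a twice differentiable λ : [0,1] → ℝᵐ such that: (1) Qᵀλ''(t) + P₁ᵀλ'(t) − P₀ᵀλ(t) = 0 for all t ∈ [0,1]; (2) −(Qᵀλ)'(1) − P₁ᵀλ(1) is a subgradient of q at x̃(1) and Qᵀλ(1) = 0; and (3) λ(t) ≥ 0 componentwise for all t, and ⟨P₀x̃(t) + P₁x̃'(t) − Qx̃''(t) − d, λ(t)⟩ = 0 for a.e. t ∈ [0,1]. Then x̃ is optimal: q(x(1)) ≥ q(x̃(1)) for every feasible arc x. -/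
open scoped RealInnerProductSpace
open Set MeasureTheory

noncomputable section

/-- Feasible arcs for the polyhedral Mayer problem: `x` is twice differentiable
on `[0,1]` with integrable second derivative, satisfies the componentwise linear
inequality `P₀x(t) + P₁x'(t) − Qx''(t) ≤ d` a.e. (where `p0 k`, `p1 k`, `p2 k`
are the rows of `P₀`, `P₁`, `Q`), and the initial conditions. -/
def FeasiblePoly (n m : ℕ) (p0 p1 p2 : Fin m → E n) (d : Fin m → ℝ) (v0 v1 : E n)
    (x x' x'' : ℝ → E n) : Prop :=
  (∀ t ∈ Icc (0 : ℝ) 1, HasDerivWithinAt x (x' t) (Icc 0 1) t) ∧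
  (∀ t ∈ Icc (0 : ℝ) 1, HasDerivWithinAt x' (x'' t) (Icc 0 1) t) ∧
  IntegrableOn x'' (Icc (0 : ℝ) 1) ∧
  (∀ᵐ t : ℝ ∂volume, t ∈ Icc (0 : ℝ) 1 → ∀ k,
    ⟪p0 k, x t⟫ + ⟪p1 k, x' t⟫ - ⟪p2 k, x'' t⟫ ≤ d k) ∧
  x 0 = v0 ∧ x' 0 = v1

/-- A function on `[a, b]` whose derivative is integrable and almost everywhere nonnegative does not
decrease from `a` to `b`. -/
theorem le_of_hasDerivWithinAt_of_ae_nonneg {F F' : ℝ → ℝ} {a b : ℝ} (hab : a ≤ b)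
    (hF : ∀ t ∈ Icc a b, HasDerivWithinAt F (F' t) (Icc a b) t)
    (hint : IntegrableOn F' (Icc a b))
    (hnonneg : ∀ᵐ t : ℝ ∂volume, t ∈ Icc a b → 0 ≤ F' t) : F a ≤ F b := by
  have hftc : ∫ t in a..b, F' t = F b - F a := by
    refine intervalIntegral.integral_eq_sub_of_hasDeriv_right_of_le hab
      (fun t ht => (hF t ht).continuousWithinAt) (fun t ht => ?_)
      ((intervalIntegrable_iff_integrableOn_Icc_of_le hab).2 hint)
    exact ((hF t (Ioo_subset_Icc_self ht)).hasDerivAt (Icc_mem_nhds ht.1 ht.2)).hasDerivWithinAt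
  have hpos : 0 ≤ ∫ t in a..b, F' t := by
    refine intervalIntegral.integral_nonneg_of_ae_restrict hab ?_
    exact (ae_restrict_iff' measurableSet_Icc).2 hnonneg
  linarith

/-- The adjoint identity: along a solution `lam` of the adjoint equation, the derivative of the
bilinear concomitant of `lam` and `y` is `-⟨P₀y + P₁y' - Qy'', lam⟩`. -/
theorem hasDerivWithinAt_concomitant {n m : ℕ} {p0 p1 p2 : Fin m → E n} {s : Set ℝ} {t : ℝ}
    {y y' : ℝ → E n} {y'' : E n} {lam lam' : ℝ → Fin m → ℝ} {lam'' : Fin m → ℝ}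
    (hy : HasDerivWithinAt y (y' t) s t) (hy' : HasDerivWithinAt y' y'' s t)
    (hlam : HasDerivWithinAt lam (lam' t) s t) (hlam' : HasDerivWithinAt lam' lam'' s t)
    (hadj : (∑ k, lam'' k • p2 k) + (∑ k, lam' t k • p1 k) - (∑ k, lam t k • p0 k) = 0) :
    HasDerivWithinAt
      (fun τ => ∑ k, (lam τ k * ⟪p2 k, y' τ⟫ - lam' τ k * ⟪p2 k, y τ⟫ - lam τ k * ⟪p1 k, y τ⟫))
      (∑ k, lam t k * (⟪p2 k, y''⟫ - ⟪p1 k, y' t⟫ - ⟪p0 k, y t⟫)) s t := by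
  have hinner : ∀ (p : E n) {z : ℝ → E n} {z' : E n}, HasDerivWithinAt z z' s t →
      HasDerivWithinAt (fun τ => ⟪p, z τ⟫) ⟪p, z'⟫ s t := fun p z z' hz => by
    simpa using (hasDerivWithinAt_const t s p).inner ℝ hz
  have hl := hasDerivWithinAt_pi.1 hlam
  have hl' := hasDerivWithinAt_pi.1 hlam'
  refine (HasDerivWithinAt.fun_sum fun k _ =>
    (((hl k).mul (hinner (p2 k) hy')).sub ((hl' k).mul (hinner (p2 k) hy))).sub
      ((hl k).mul (hinner (p1 k) hy))).congr_deriv ?_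
  have h := congrArg (fun v => ⟪v, y t⟫) hadj
  simp only [inner_sub_left, inner_add_left, sum_inner, real_inner_smul_left,
    inner_zero_left] at h
  rw [← sub_eq_zero, ← Finset.sum_sub_distrib, ← neg_eq_zero, ← h, ← Finset.sum_add_distrib,
    ← Finset.sum_sub_distrib, ← Finset.sum_neg_distrib]
  exact Finset.sum_congr rfl fun k _ => by ring

theorem stmt14 (n m : ℕ) (p0 p1 p2 : Fin m → E n) (d : Fin m → ℝ)
    (q : E n → ℝ) (hq : ConvexOn ℝ univ q) (v0 v1 : E n)
    (xtil xtil' xtil'' : ℝ → E n)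
    (hfeas : FeasiblePoly n m p0 p1 p2 d v0 v1 xtil xtil' xtil'')
    (lam lam' lam'' : ℝ → Fin m → ℝ)
    (hlam : ∀ t ∈ Icc (0 : ℝ) 1, HasDerivWithinAt lam (lam' t) (Icc 0 1) t)
    (hlam' : ∀ t ∈ Icc (0 : ℝ) 1, HasDerivWithinAt lam' (lam'' t) (Icc 0 1) t)
    -- (1)  Qᵀλ''(t) + P₁ᵀλ'(t) − P₀ᵀλ(t) = 0
    (h1 : ∀ t ∈ Icc (0 : ℝ) 1,
      (∑ k, lam'' t k • p2 k) + (∑ k, lam' t k • p1 k) - (∑ k, lam t k • p0 k) = 0)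
    -- (2)  −(Qᵀλ)'(1) − P₁ᵀλ(1) ∈ ∂q(x̃(1)) and Qᵀλ(1) = 0
    (h2 : IsSubgrad1 q (xtil 1) (-(∑ k, lam' 1 k • p2 k) - ∑ k, lam 1 k • p1 k))
    (h2' : (∑ k, lam 1 k • p2 k) = 0)
    -- (3)  λ(t) ≥ 0 and complementary slackness
    (h3 : ∀ t ∈ Icc (0 : ℝ) 1, ∀ k, 0 ≤ lam t k)
    (h3' : ∀ᵐ t : ℝ ∂volume, t ∈ Icc (0 : ℝ) 1 →
      ∑ k, lam t k * (⟪p0 k, xtil t⟫ + ⟪p1 k, xtil' t⟫ - ⟪p2 k, xtil'' t⟫ - d k) = 0) :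
    ∀ x x' x'' : ℝ → E n, FeasiblePoly n m p0 p1 p2 d v0 v1 x x' x'' →
      q (x 1) ≥ q (xtil 1) := by
  rintro x x' x'' ⟨hx, hx', hx'', hineq, hx0, hx'0⟩
  obtain ⟨hxt, hxt', hxt'', -, hxt0, hxt'0⟩ := hfeas
  have hy : ∀ t ∈ Icc (0 : ℝ) 1,
      HasDerivWithinAt (fun τ => x τ - xtil τ) (x' t - xtil' t) (Icc 0 1) t :=
    fun t ht => (hx t ht).sub (hxt t ht)
  have hy' : ∀ t ∈ Icc (0 : ℝ) 1,
      HasDerivWithinAt (fun τ => x' τ - xtil' τ) (x'' t - xtil'' t) (Icc 0 1) t :=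
    fun t ht => (hx' t ht).sub (hxt' t ht)
  have hlamc : ∀ k, ContinuousOn (fun t => lam t k) (Icc 0 1) := fun k t ht =>
    (hasDerivWithinAt_pi.1 (hlam t ht) k).continuousWithinAt
  have hyc : ContinuousOn (fun t => x t - xtil t) (Icc 0 1) := fun t ht =>
    (hy t ht).continuousWithinAt
  have hyc' : ContinuousOn (fun t => x' t - xtil' t) (Icc 0 1) := fun t ht =>
    (hy' t ht).continuousWithinAt
  have hmono := le_of_hasDerivWithinAt_of_ae_nonneg zero_le_one
    (fun t ht => hasDerivWithinAt_concomitant (hy t ht) (hy' t ht) (hlam t ht) (hlam' t ht)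
      (h1 t ht)) ?_ ?_
  · have hs := h2 (x 1)
    have hQ := congrArg (fun v => ⟪v, x' 1 - xtil' 1⟫) h2'
    simp only [hx0, hxt0, hx'0, hxt'0, sub_self, inner_zero_right, mul_zero,
      Finset.sum_const_zero, Finset.sum_sub_distrib] at hmono
    simp only [sum_inner, real_inner_smul_left, inner_zero_left] at hQ
    simp only [inner_sub_left, inner_neg_left, sum_inner, real_inner_smul_left] at hs
    linarith
  · refine integrable_finsetSum _ fun k _ => ?_
    refine IntegrableOn.continuousOn_mul (hlamc k) ?_ isCompact_Icc
    refine Integrable.sub (Integrable.sub ((hx''.sub hxt'').const_inner (p2 k)) ?_) ?_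
    · exact (continuousOn_const.inner hyc').integrableOn_compact isCompact_Icc
    · exact (continuousOn_const.inner hyc).integrableOn_compact isCompact_Icc
  · filter_upwards [hineq, h3'] with t hle hslack ht
    rw [← hslack ht]
    refine Finset.sum_le_sum fun k _ => mul_le_mul_of_nonneg_left ?_ (h3 t ht k)
    have := hle ht k
    simp only [inner_sub_right]
    linarith
end
end

section
/- Consider the (possibly nonconvex) problem (PC): minimize J[x] = ∫₀¹ f(x(t), t) dt + q(x(1)) over feasible arcs, where an arc x : [0,1] → ℝⁿ is feasible if it is twice differentiable with integrable second derivative, W_k(x(t), x'(t), x''(t)) ≤ 0 for a.e. t ∈ [0,1] (k = 1, …, m), and x(0) = v₀, x'(0) = v₁; here f(·, t) : ℝⁿ → ℝ, W_k : ℝⁿ × ℝⁿ × ℝⁿ → ℝ and q : ℝⁿ → ℝ need not be convex, and t ↦ f(x(t), t) is integrable along feasible arcs. Let x̃ be a feasible arc and suppose there exist functions x*, ψ*, v* : [0,1] → ℝⁿ with x* twice differentiable and ψ* differentiable (with integrable derivatives of the relevant orders) and measurable α_k : [0,1] → [0,∞) such that for almost every t ∈ [0,1]: (a₁) for all (x,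 v₁, v₂) ∈ ℝⁿ × ℝⁿ × ℝⁿ, ∑_{k=1}^m α_k(t)·(W_k(x, v₁, v₂) − W_k(x̃(t), x̃'(t), x̃''(t))) ≥ ⟨x*''(t) + ψ*'(t) − v*(t), x − x̃(t)⟩ + ⟨ψ*(t), v₁ − x̃'(t)⟩ + ⟨−x*(t), v₂ − x̃''(t)⟩; (b₁) f(x, t) − f(x̃(t), t) ≥ ⟨v*(t), x − x̃(t)⟩ for all x ∈ ℝⁿ; (c₁) q(x) − q(x̃(1)) ≥ −⟨ψ*(1) + x*'(1), x − x̃(1)⟩ for all x ∈ ℝⁿ, and x*(1) = 0; and (d₁) α_k(t)·W_k(x̃(t), x̃'(t), x̃''(t)) = 0 for every k. Then x̃ is optimal: J[x] ≥ J[x̃] for every feasible arc x. -/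
open scoped RealInnerProductSpace
open Set MeasureTheory

noncomputable section

/-- Feasible arcs for problem (PC). -/
def FeasiblePC (n m : ℕ) (W : Fin m → E n × E n × E n → ℝ) (v0 v1 : E n)
    (x x' x'' : ℝ → E n) : Prop :=
  (∀ t ∈ Icc (0 : ℝ) 1, HasDerivWithinAt x (x' t) (Icc 0 1) t) ∧
  (∀ t ∈ Icc (0 : ℝ) 1, HasDerivWithinAt x' (x'' t) (Icc 0 1) t) ∧
  IntegrableOn x'' (Icc (0 : ℝ) 1) ∧
  (∀ᵐ t : ℝ ∂volume, t ∈ Icc (0 : ℝ) 1 → ∀ k, W k (x t, x' t, x'' t) ≤ 0) ∧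
  x 0 = v0 ∧ x' 0 = v1

/-- The Bolza cost functional. -/
def J (n : ℕ) (f : ℝ → E n → ℝ) (q : E n → ℝ) (x : ℝ → E n) : ℝ :=
  (∫ t in (0 : ℝ)..1, f t (x t)) + q (x 1)

/-- The inner product of an integrable function with a continuous one is integrable on a
compact set. -/
theorem integrableOn_inner_of_continuousOn {F : Type*} [NormedAddCommGroup F]
    [InnerProductSpace ℝ F] {s : Set ℝ} {u v : ℝ → F} (hs : IsCompact s)
    (hu : IntegrableOn u s) (hv : ContinuousOn v s) :
    IntegrableOn (fun t => ⟪u t, v t⟫) s := by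
  obtain ⟨C, hC⟩ := hs.exists_bound_of_continuousOn hv
  have hvm : AEStronglyMeasurable v (volume.restrict s) :=
    hv.aestronglyMeasurable_of_isCompact hs hs.measurableSet
  refine (hu.norm.mul_const C).mono' (hu.aestronglyMeasurable.inner hvm) ?_
  filter_upwards [ae_restrict_mem hs.measurableSet] with t ht
  exact (norm_inner_le_norm _ _).trans (by gcongr; exact hC t ht)

theorem stmt15 (n m : ℕ) (v0 v1 : E n)
    (f : ℝ → E n → ℝ) (q : E n → ℝ)
    (W : Fin m → E n × E n × E n → ℝ)
    (hfint : ∀ x x' x'' : ℝ → E n, FeasiblePC n m W v0 v1 x x' x'' →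
      IntervalIntegrable (fun t => f t (x t)) volume 0 1)
    (xtil xtil' xtil'' : ℝ → E n)
    (hfeas : FeasiblePC n m W v0 v1 xtil xtil' xtil'')
    (xs xs' xs'' ψs ψs' vs : ℝ → E n)
    (hxs : ∀ t ∈ Icc (0 : ℝ) 1, HasDerivWithinAt xs (xs' t) (Icc 0 1) t)
    (hxs' : ∀ t ∈ Icc (0 : ℝ) 1, HasDerivWithinAt xs' (xs'' t) (Icc 0 1) t)
    (hψs : ∀ t ∈ Icc (0 : ℝ) 1, HasDerivWithinAt ψs (ψs' t) (Icc 0 1) t)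
    (hxsint : IntegrableOn xs'' (Icc (0 : ℝ) 1))
    (hψsint : IntegrableOn ψs' (Icc (0 : ℝ) 1))
    (α : Fin m → ℝ → ℝ)
    (hαmeas : ∀ k, Measurable (α k))
    (hαpos : ∀ k, ∀ t ∈ Icc (0 : ℝ) 1, 0 ≤ α k t)
    -- (a₁) global subgradient-type inequality for the weighted constraints,
    -- (b₁) global subgradient-type inequality for f, and
    -- (d₁) complementary slackness, a.e. on [0,1]
    (ha₁b₁d₁ : ∀ᵐ t : ℝ ∂volume, t ∈ Icc (0 : ℝ) 1 →
      (∀ x v₁ v₂ : E n,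
        ∑ k, α k t * (W k (x, v₁, v₂) - W k (xtil t, xtil' t, xtil'' t)) ≥
          ⟪xs'' t + ψs' t - vs t, x - xtil t⟫ + ⟪ψs t, v₁ - xtil' t⟫ +
            ⟪-xs t, v₂ - xtil'' t⟫) ∧
      (∀ x : E n, f t x - f t (xtil t) ≥ ⟪vs t, x - xtil t⟫) ∧
      (∀ k, α k t * W k (xtil t, xtil' t, xtil'' t) = 0))
    -- (c₁) transversality conditions
    (hc₁ : ∀ x : E n, q x - q (xtil 1) ≥ -⟪ψs 1 + xs' 1, x - xtil 1⟫)
    (hend : xs 1 = 0) :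
    ∀ x x' x'' : ℝ → E n, FeasiblePC n m W v0 v1 x x' x'' →
      J n f q x ≥ J n f q xtil := by
  intro x x' x'' hx
  have hfx := hfint x x' x'' hx
  have hft := hfint xtil xtil' xtil'' hfeas
  obtain ⟨hx1, hx2, hx3, hx4, hx5, hx6⟩ := hx
  obtain ⟨ht1, ht2, ht3, -, ht5, ht6⟩ := hfeas
  have hh : ∀ t ∈ Icc (0 : ℝ) 1,
      HasDerivWithinAt (fun t => x t - xtil t) (x' t - xtil' t) (Icc 0 1) t :=
    fun t ht => (hx1 t ht).sub (ht1 t ht)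
  have hh' : ∀ t ∈ Icc (0 : ℝ) 1,
      HasDerivWithinAt (fun t => x' t - xtil' t) (x'' t - xtil'' t) (Icc 0 1) t :=
    fun t ht => (hx2 t ht).sub (ht2 t ht)
  have ch : ContinuousOn (fun t => x t - xtil t) (Icc 0 1) :=
    fun t ht => (hh t ht).continuousWithinAt
  have ch' : ContinuousOn (fun t => x' t - xtil' t) (Icc 0 1) :=
    fun t ht => (hh' t ht).continuousWithinAt
  have cxs : ContinuousOn xs (Icc 0 1) := fun t ht => (hxs t ht).continuousWithinAt
  have cψs : ContinuousOn ψs (Icc 0 1) := fun t ht => (hψs t ht).continuousWithinAt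
  let G : ℝ → ℝ := fun t =>
    ⟪xs' t, x t - xtil t⟫ - ⟪x' t - xtil' t, xs t⟫ + ⟪ψs t, x t - xtil t⟫
  let g : ℝ → ℝ := fun t =>
    ⟪xs'' t, x t - xtil t⟫ - ⟪x'' t - xtil'' t, xs t⟫
      + (⟪ψs' t, x t - xtil t⟫ + ⟪ψs t, x' t - xtil' t⟫)
  have hG : ∀ t ∈ Icc (0 : ℝ) 1, HasDerivWithinAt G (g t) (Icc 0 1) t := by
    intro t ht
    refine ((((hxs' t ht).inner ℝ (hh t ht)).sub ((hh' t ht).inner ℝ (hxs t ht))).add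
      ((hψs t ht).inner ℝ (hh t ht))).congr_deriv ?_
    simp only [g, real_inner_comm (xs' t)]
    ring
  have hg : IntervalIntegrable g volume 0 1 := by
    rw [intervalIntegrable_iff_integrableOn_Icc_of_le zero_le_one]
    exact ((integrableOn_inner_of_continuousOn isCompact_Icc hxsint ch).sub
      (integrableOn_inner_of_continuousOn isCompact_Icc (hx3.sub ht3) cxs)).add
      ((integrableOn_inner_of_continuousOn isCompact_Icc hψsint ch).add
        (cψs.inner ch').integrableOn_Icc)
  have hFTC : ∫ t in (0 : ℝ)..1, g t = G 1 - G 0 := by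
    refine intervalIntegral.integral_eq_sub_of_hasDerivAt_of_le zero_le_one
      (fun t ht => (hG t ht).continuousWithinAt) (fun t ht => ?_) hg
    exact (hG t (Ioo_subset_Icc_self ht)).hasDerivAt (Icc_mem_nhds ht.1 ht.2)
  have hG0 : G 0 = 0 := by simp [G, hx5, hx6, ht5, ht6]
  have hG1 : G 1 = ⟪ψs 1 + xs' 1, x 1 - xtil 1⟫ := by
    simp only [G, hend, inner_zero_right, inner_add_left]
    ring
  have hle : ∫ t in (0 : ℝ)..1, g t ≤ ∫ t in (0 : ℝ)..1, (f t (x t) - f t (xtil t)) := by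
    refine intervalIntegral.integral_mono_ae_restrict zero_le_one hg (hfx.sub hft) ?_
    filter_upwards [ae_restrict_mem measurableSet_Icc, ae_restrict_of_ae ha₁b₁d₁,
      ae_restrict_of_ae hx4] with t ht hopt hW
    obtain ⟨ha, hb, hd⟩ := hopt ht
    have hsum : ∑ k, α k t * (W k (x t, x' t, x'' t) - W k (xtil t, xtil' t, xtil'' t)) ≤ 0 := by
      refine Finset.sum_nonpos fun k _ => ?_
      rw [mul_sub, hd k, sub_zero]
      exact mul_nonpos_of_nonneg_of_nonpos (hαpos k t ht) (hW ht k)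
    have ha := ha (x t) (x' t) (x'' t)
    have hb := hb (x t)
    rw [inner_sub_left, inner_add_left, inner_neg_left] at ha
    simp only [g]
    rw [real_inner_comm (xs t)]
    linarith
  rw [intervalIntegral.integral_sub hfx hft, hFTC, hG0, hG1] at hle
  have hq := hc₁ (x 1)
  simp only [J]
  linarith
end
end
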